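/- Let N be a positive integer, σ ∈ (0, 2), and a > N. Then there exists a constant C > 0 (depending on N, σ, a) such that for every x ∈ ℝ^N the integral ∫_{ℝ^N} |2ϑ_a(x) − ϑ_a(x+z) − ϑ_a(x−z)| / |z|^{N+σ} dz converges and is bounded by C / (1 + |x|^{N+σ}). -/

import Mathlib

open MeasureTheory ENNReal

/-- The weight `ϑ_a(x) = (1 + ((|x|²-1)₊)⁴)^(-a/8)` of the class `Θ`. -/
noncomputable def fdeWeight (N : ℕ) (a : ℝ) (x : EuclideanSpace ℝ (Fin N)) : ℝ :=
  (1 + max (‖x‖ ^ 2 - 1) 0 ^ 4) ^ (-(a / 8))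
/-- The derivative of `s ↦ (s₊)^(n+2)`. -/
theorem hasDerivAt_max_zero_pow (n : ℕ) (s : ℝ) :
    HasDerivAt (fun s : ℝ => max s 0 ^ (n + 2)) ((n + 2) * max s 0 ^ (n + 1)) s := by
  rcases lt_trichotomy s 0 with hs | rfl | hs
  · have h : (fun s : ℝ => max s 0 ^ (n + 2)) =ᶠ[nhds s] fun _ => 0 := by
      filter_upwards [gt_mem_nhds hs] with t ht
      simp [max_eq_right ht.le]
    simpa [max_eq_right hs.le] using (hasDerivAt_const s (0 : ℝ)).congr_of_eventuallyEq h
  · have h : (fun s : ℝ => max s 0 ^ (n + 2)) =O[nhds 0] fun s => ‖s - 0‖ ^ (n + 2) := by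
      refine .of_bound 1 (.of_forall fun s => ?_)
      have : |max s 0| ≤ |s| := by
        rw [abs_of_nonneg (le_max_right _ _)]
        exact max_le (le_abs_self s) (abs_nonneg s)
      simpa using pow_le_pow_left₀ (abs_nonneg _) this (n + 2)
    simpa using (h.hasFDerivAt (𝕜 := ℝ) (by omega)).hasDerivAt
  · have h : (fun s : ℝ => max s 0 ^ (n + 2)) =ᶠ[nhds s] fun s => s ^ (n + 2) := by
      filter_upwards [lt_mem_nhds hs] with t ht
      simp [max_eq_left ht.le]
    simpa [max_eq_left hs.le] using (hasDerivAt_pow (n + 2) s).congr_of_eventuallyEq h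

/-- A second difference is controlled by the second derivative. -/
theorem abs_second_difference_le {g g' g'' : ℝ → ℝ} {M : ℝ}
    (hg : ∀ t, HasDerivAt g (g' t) t) (hg' : ∀ t, HasDerivAt g' (g'' t) t)
    (hM : ∀ t ∈ Set.Icc (-1 : ℝ) 1, |g'' t| ≤ M) :
    |2 * g 0 - g 1 - g (-1)| ≤ 2 * M := by
  have hM0 : 0 ≤ M := (abs_nonneg _).trans (hM 0 (by simp))
  have hG : ∀ t, HasDerivAt (fun t => g t + g (-t)) (g' t - g' (-t)) t := fun t => by
    have h := (hg t).add ((hg (-t)).comp t (hasDerivAt_neg t))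
    exact h.congr_deriv (by ring)
  have hslope : ∀ t ∈ Set.Icc (0 : ℝ) 1, ‖g' t - g' (-t)‖ ≤ 2 * M := fun t ht => by
    have h := (convex_Icc (-1 : ℝ) 1).norm_image_sub_le_of_norm_hasDerivWithin_le
      (fun t _ => (hg' t).hasDerivWithinAt) hM (x := -t) (y := t)
      ⟨by linarith [ht.2], by linarith [ht.1]⟩ ⟨by linarith [ht.1], ht.2⟩
    have h2 : ‖t - -t‖ ≤ 2 := by
      rw [Real.norm_eq_abs, abs_le]
      constructor <;> linarith [ht.1, ht.2]
    nlinarith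
  have h := (convex_Icc (0 : ℝ) 1).norm_image_sub_le_of_norm_hasDerivWithin_le
    (fun t _ => (hG t).hasDerivWithinAt) hslope (x := 0) (y := 1) (by simp) (by simp)
  simp only [neg_zero, sub_zero, norm_one, mul_one, Real.norm_eq_abs] at h
  rw [show 2 * g 0 - g 1 - g (-1) = -(g 1 + g (-1) - (g 0 + g 0)) by ring, abs_neg]
  exact h

/-- The first derivative of the profile `s ↦ (1 + s₊⁴)^(-b)`. -/
noncomputable def profileDeriv (b s : ℝ) : ℝ :=
  4 * max s 0 ^ 3 * -b * (1 + max s 0 ^ 4) ^ (-(b + 1))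

/-- The second derivative of the profile `s ↦ (1 + s₊⁴)^(-b)`. -/
noncomputable def profileDeriv2 (b s : ℝ) : ℝ :=
  12 * max s 0 ^ 2 * -b * (1 + max s 0 ^ 4) ^ (-(b + 1)) +
    16 * max s 0 ^ 6 * (b * (b + 1)) * (1 + max s 0 ^ 4) ^ (-(b + 2))

theorem hasDerivAt_one_add_pow_rpow (b s : ℝ) :
    HasDerivAt (fun s : ℝ => (1 + max s 0 ^ 4) ^ (-b)) (profileDeriv b s) s := by
  have h := ((hasDerivAt_max_zero_pow 2 s).const_add 1).rpow_const (p := -b)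
    (.inl (by positivity))
  convert h using 1
  rw [profileDeriv, show -b - 1 = -(b + 1) by ring]
  norm_num

theorem hasDerivAt_profileDeriv (b s : ℝ) :
    HasDerivAt (profileDeriv b) (profileDeriv2 b s) s := by
  have h := (((hasDerivAt_max_zero_pow 1 s).const_mul 4).mul_const (-b)).mul
    (hasDerivAt_one_add_pow_rpow (b + 1) s)
  refine h.congr_deriv ?_
  rw [profileDeriv, profileDeriv2, show b + 1 + 1 = b + 2 by ring]
  norm_num
  ring

theorem one_add_norm_pow_le {E : Type*} [SeminormedAddCommGroup E] (y : E) :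
    (1 + ‖y‖) ^ 8 ≤ 2048 * (1 + max (‖y‖ ^ 2 - 1) 0 ^ 4) := by
  set m := max (‖y‖ ^ 2 - 1) 0
  have hm0 : 0 ≤ m := le_max_right _ _
  have hm : ‖y‖ ^ 2 - 1 ≤ m := le_max_left _ _
  have h2 : (1 + ‖y‖) ^ 2 ≤ 4 * (1 + m) := by nlinarith [sq_nonneg (‖y‖ - 1)]
  have h4 : (1 + m) ^ 4 ≤ 8 * (1 + m ^ 4) := by
    have : (1 + m) ^ 2 ≤ 2 * (1 + m ^ 2) := by nlinarith [sq_nonneg (m - 1)]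
    nlinarith [sq_nonneg (m ^ 2 - 1), sq_nonneg (1 + m), pow_le_pow_left₀ (by positivity) this 2]
  have h8 := pow_le_pow_left₀ (by positivity) h2 4
  nlinarith

theorem profile_rpow_neg_le {E : Type*} [SeminormedAddCommGroup E] (y : E) {c : ℝ} (hc : 0 ≤ c) :
    (1 + max (‖y‖ ^ 2 - 1) 0 ^ 4) ^ (-c) ≤ 2048 ^ c * (1 + ‖y‖) ^ (-(8 * c)) := by
  have h : (1 + ‖y‖) ^ 8 / 2048 ≤ 1 + max (‖y‖ ^ 2 - 1) 0 ^ 4 := by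
    linarith [one_add_norm_pow_le y]
  refine (Real.rpow_le_rpow_of_nonpos (by positivity) h (by linarith)).trans_eq ?_
  rw [Real.div_rpow (by positivity) (by positivity), Real.rpow_neg (by norm_num : (0 : ℝ) ≤ 2048),
    ← Real.rpow_natCast, ← Real.rpow_mul (by positivity), div_inv_eq_mul, mul_comm]
  norm_num

/-- The power of `1 + ‖y‖` gained from a factor `s₊^k` and a factor `(1 + s₊⁴)^(-c)`. -/
theorem pow_mul_profile_rpow_neg_le {E : Type*} [SeminormedAddCommGroup E] (y : E) {c : ℝ}
    (hc : 0 ≤ c) (k : ℕ) :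
    max (‖y‖ ^ 2 - 1) 0 ^ k * (1 + max (‖y‖ ^ 2 - 1) 0 ^ 4) ^ (-c) ≤
      2048 ^ c * (1 + ‖y‖) ^ (2 * k - 8 * c) := by
  have hm : max (‖y‖ ^ 2 - 1) 0 ≤ (1 + ‖y‖) ^ 2 :=
    max_le (by nlinarith [norm_nonneg y]) (by positivity)
  have hk := pow_le_pow_left₀ (le_max_right _ _) hm k
  calc _ ≤ ((1 + ‖y‖) ^ 2) ^ k * (2048 ^ c * (1 + ‖y‖) ^ (-(8 * c))) := by
        gcongr
        exact profile_rpow_neg_le y hc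
    _ = 2048 ^ c * ((1 + ‖y‖) ^ ((2 * k : ℕ) : ℝ) * (1 + ‖y‖) ^ (-(8 * c))) := by
        rw [Real.rpow_natCast, pow_mul]; ring
    _ = _ := by
        rw [← Real.rpow_add (by positivity)]
        push_cast
        rfl

theorem abs_profileDeriv_le {E : Type*} [SeminormedAddCommGroup E] (y : E) {b : ℝ} (hb : 0 ≤ b) :
    |profileDeriv b (‖y‖ ^ 2 - 1)| ≤ 4 * b * 2048 ^ (b + 1) * (1 + ‖y‖) ^ (-(8 * b + 2)) := by
  have h := pow_mul_profile_rpow_neg_le y (by linarith : 0 ≤ b + 1) 3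
  rw [profileDeriv, mul_neg, neg_mul, abs_neg, abs_of_nonneg (by positivity)]
  rw [show 2 * ((3 : ℕ) : ℝ) - 8 * (b + 1) = -(8 * b + 2) by push_cast; ring] at h
  nlinarith [mul_le_mul_of_nonneg_left h (by positivity : 0 ≤ 4 * b)]

theorem abs_profileDeriv2_mul_le {E : Type*} [SeminormedAddCommGroup E] (y : E) {b : ℝ}
    (hb : 0 ≤ b) :
    |profileDeriv2 b (‖y‖ ^ 2 - 1)| * ‖y‖ ^ 2 ≤
      (12 * b * 2048 ^ (b + 1) + 16 * (b * (b + 1)) * 2048 ^ (b + 2)) *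
        (1 + ‖y‖) ^ (-(8 * b + 2)) := by
  have h1 := pow_mul_profile_rpow_neg_le y (by linarith : 0 ≤ b + 1) 2
  have h2 := pow_mul_profile_rpow_neg_le y (by linarith : 0 ≤ b + 2) 6
  rw [show 2 * ((2 : ℕ) : ℝ) - 8 * (b + 1) = -(8 * b + 4) by push_cast; ring] at h1
  rw [show 2 * ((6 : ℕ) : ℝ) - 8 * (b + 2) = -(8 * b + 4) by push_cast; ring] at h2
  have habs : |profileDeriv2 b (‖y‖ ^ 2 - 1)| ≤
      (12 * b * 2048 ^ (b + 1) + 16 * (b * (b + 1)) * 2048 ^ (b + 2)) *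
        (1 + ‖y‖) ^ (-(8 * b + 4)) := by
    refine (abs_add_le _ _).trans ?_
    rw [mul_neg, neg_mul, abs_neg, abs_of_nonneg (by positivity), abs_of_nonneg (by positivity)]
    nlinarith [mul_le_mul_of_nonneg_left h1 (by positivity : 0 ≤ 12 * b),
      mul_le_mul_of_nonneg_left h2 (by positivity : 0 ≤ 16 * (b * (b + 1)))]
  calc _ ≤ (12 * b * 2048 ^ (b + 1) + 16 * (b * (b + 1)) * 2048 ^ (b + 2)) *
        (1 + ‖y‖) ^ (-(8 * b + 4)) * (1 + ‖y‖) ^ 2 := by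
        gcongr
        linarith
    _ = _ := by
        rw [mul_assoc, ← Real.rpow_natCast (1 + ‖y‖) 2, ← Real.rpow_add (by positivity)]
        congr 2
        push_cast
        ring

theorem fdeWeight_nonneg (N : ℕ) (a : ℝ) (x : EuclideanSpace ℝ (Fin N)) :
    0 ≤ fdeWeight N a x := by
  unfold fdeWeight
  positivity

theorem fdeWeight_le (N : ℕ) {a : ℝ} (ha : 0 ≤ a) (x : EuclideanSpace ℝ (Fin N)) :
    fdeWeight N a x ≤ 2048 ^ (a / 8) * (1 + ‖x‖) ^ (-a) := by
  have h := profile_rpow_neg_le x (by positivity : 0 ≤ a / 8)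
  rwa [mul_div_cancel₀ a (by norm_num : (8 : ℝ) ≠ 0)] at h

theorem measurable_fdeWeight (N : ℕ) (a : ℝ) : Measurable (fdeWeight N a) := by
  unfold fdeWeight
  fun_prop

theorem lintegral_fdeWeight_lt_top (N : ℕ) {a : ℝ} (ha : (N : ℝ) < a) :
    ∫⁻ x, ENNReal.ofReal (fdeWeight N a x) < ∞ := by
  have ha0 : 0 ≤ a := N.cast_nonneg.trans ha.le
  have hdom := (integrable_one_add_norm (E := EuclideanSpace ℝ (Fin N)) (μ := volume) (r := a)
    (by simpa using ha)).const_mul (2048 ^ (a / 8))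
  exact (lintegral_mono fun x => ENNReal.ofReal_le_ofReal (fdeWeight_le N ha0 x)).trans_lt
    hdom.lintegral_lt_top

/-- Second differences of the weight over steps shorter than `(1 + ‖x‖) / 2` gain two powers. -/
theorem exists_fdeWeight_second_difference_le (N : ℕ) {a : ℝ} (ha : 0 ≤ a) :
    ∃ M : ℝ, 0 ≤ M ∧ ∀ x z : EuclideanSpace ℝ (Fin N), ‖z‖ ≤ (1 + ‖x‖) / 2 →
      |2 * fdeWeight N a x - fdeWeight N a (x + z) - fdeWeight N a (x - z)| ≤
        M * (1 + ‖x‖) ^ (-(a + 2)) * ‖z‖ ^ 2 := by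
  set b := a / 8 with hb_def
  have hb : 0 ≤ b := by positivity
  have h8b : 8 * b = a := by rw [hb_def]; ring
  set K₁ : ℝ := 4 * b * 2048 ^ (b + 1)
  set K₂ : ℝ := 12 * b * 2048 ^ (b + 1) + 16 * (b * (b + 1)) * 2048 ^ (b + 2)
  have hK₁ : 0 ≤ K₁ := by positivity
  have hK₂ : 0 ≤ K₂ := by positivity
  refine ⟨2 * ((4 * K₂ + 2 * K₁) * 2 ^ (a + 2)), by positivity, fun x z hz => ?_⟩
  have hq : ∀ t : ℝ, HasDerivAt (fun t : ℝ => ‖x + t • z‖ ^ 2 - 1)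
      (2 * inner ℝ (x + t • z) z) t := fun t => by
    have hy : HasDerivAt (fun t : ℝ => x + t • z) z t := by
      simpa using ((hasDerivAt_id t).smul_const z).const_add x
    exact hy.norm_sq.sub_const 1
  have hq' : ∀ t : ℝ, HasDerivAt (fun t : ℝ => 2 * inner ℝ (x + t • z) z)
      (2 * ‖z‖ ^ 2) t := fun t => by
    have hy : HasDerivAt (fun t : ℝ => x + t • z) z t := by
      simpa using ((hasDerivAt_id t).smul_const z).const_add x
    simpa using (hy.inner ℝ (hasDerivAt_const t z)).const_mul 2
  have key := abs_second_difference_le (g := fun t => fdeWeight N a (x + t • z))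
    (M := (4 * K₂ + 2 * K₁) * 2 ^ (a + 2) * (1 + ‖x‖) ^ (-(a + 2)) * ‖z‖ ^ 2)
    (fun t => (hasDerivAt_one_add_pow_rpow b _).comp t (hq t))
    (fun t => ((hasDerivAt_profileDeriv b _).comp t (hq t)).mul (hq' t)) ?_
  · simpa [sub_eq_add_neg, mul_assoc] using key
  intro t ht
  set y := x + t • z
  have h1 := abs_profileDeriv_le y hb
  have h2 := abs_profileDeriv2_mul_le y hb
  rw [h8b] at h1 h2
  have hyx : (1 + ‖x‖) / 2 ≤ 1 + ‖y‖ := by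
    have htz : ‖t • z‖ ≤ ‖z‖ := by
      rw [norm_smul]
      exact mul_le_of_le_one_left (norm_nonneg _) (abs_le.2 ht)
    have : ‖x‖ ≤ ‖y‖ + ‖t • z‖ := by simpa [y] using norm_sub_le y (t • z)
    linarith
  have hpow : (1 + ‖y‖) ^ (-(a + 2)) ≤ 2 ^ (a + 2) * (1 + ‖x‖) ^ (-(a + 2)) := by
    refine (Real.rpow_le_rpow_of_nonpos (by positivity) hyx (by linarith)).trans_eq ?_
    rw [Real.div_rpow (by positivity) (by positivity), Real.rpow_neg zero_le_two,
      div_inv_eq_mul, mul_comm]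
  have hinner : (2 * inner ℝ y z) ^ 2 ≤ 4 * (‖y‖ ^ 2 * ‖z‖ ^ 2) := by
    have := pow_le_pow_left₀ (abs_nonneg _) (abs_real_inner_le_norm y z) 2
    rw [sq_abs] at this
    nlinarith
  simp only [Function.comp_apply]
  calc |profileDeriv2 b (‖y‖ ^ 2 - 1) * (2 * inner ℝ y z) * (2 * inner ℝ y z) +
        profileDeriv b (‖y‖ ^ 2 - 1) * (2 * ‖z‖ ^ 2)|
      ≤ |profileDeriv2 b (‖y‖ ^ 2 - 1)| * (2 * inner ℝ y z) ^ 2 +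
        |profileDeriv b (‖y‖ ^ 2 - 1)| * (2 * ‖z‖ ^ 2) := by
        refine (abs_add_le _ _).trans_eq ?_
        rw [mul_assoc, ← sq, abs_mul, abs_mul, abs_of_nonneg (sq_nonneg (2 * inner ℝ y z)),
          abs_of_nonneg (by positivity : 0 ≤ 2 * ‖z‖ ^ 2)]
    _ ≤ |profileDeriv2 b (‖y‖ ^ 2 - 1)| * (4 * (‖y‖ ^ 2 * ‖z‖ ^ 2)) +
        |profileDeriv b (‖y‖ ^ 2 - 1)| * (2 * ‖z‖ ^ 2) := by gcongr
    _ = (4 * (|profileDeriv2 b (‖y‖ ^ 2 - 1)| * ‖y‖ ^ 2) +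
        2 * |profileDeriv b (‖y‖ ^ 2 - 1)|) * ‖z‖ ^ 2 := by ring
    _ ≤ (4 * (K₂ * (1 + ‖y‖) ^ (-(a + 2))) + 2 * (K₁ * (1 + ‖y‖) ^ (-(a + 2)))) * ‖z‖ ^ 2 := by
        gcongr
    _ = (4 * K₂ + 2 * K₁) * (1 + ‖y‖) ^ (-(a + 2)) * ‖z‖ ^ 2 := by ring
    _ ≤ (4 * K₂ + 2 * K₁) * (2 ^ (a + 2) * (1 + ‖x‖) ^ (-(a + 2))) * ‖z‖ ^ 2 := by gcongr
    _ = _ := by ring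

/-- The Lévy kernel `min(|z|², 1) / |z|^(N+σ)` is integrable. -/
theorem integrable_min_norm_sq_mul_rpow (N : ℕ) (hN : 0 < N) {σ : ℝ} (hσ0 : 0 < σ) (hσ2 : σ < 2) :
    Integrable fun z : EuclideanSpace ℝ (Fin N) =>
      min (‖z‖ ^ 2) 1 * ‖z‖ ^ (-((N : ℝ) + σ)) := by
  have : Nonempty (Fin N) := ⟨⟨0, hN⟩⟩
  rw [integrable_fun_norm_addHaar volume (f := fun r : ℝ => min (r ^ 2) 1 * r ^ (-((N : ℝ) + σ))),
    finrank_euclideanSpace_fin, ← Set.Ioc_union_Ioi_eq_Ioi zero_le_one, integrableOn_union]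
  have hpow : ∀ r : ℝ, 0 < r → r ^ (N - 1) * r ^ (-((N : ℝ) + σ)) = r ^ (-1 - σ) := fun r hr => by
    rw [← Real.rpow_natCast, ← Real.rpow_add hr, Nat.cast_pred hN]
    congr 1
    ring
  constructor
  · have h : IntegrableOn (fun r : ℝ => r ^ (1 - σ)) (Set.Ioc 0 1) := by
      rw [← intervalIntegrable_iff_integrableOn_Ioc_of_le zero_le_one]
      exact intervalIntegral.intervalIntegrable_rpow' (by linarith)
    refine h.congr_fun (fun r hr => ?_) measurableSet_Ioc
    have hr2 : r ^ 2 ≤ 1 := pow_le_one₀ hr.1.le hr.2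
    simp only [smul_eq_mul, min_eq_left hr2]
    rw [mul_left_comm, hpow r hr.1, ← Real.rpow_natCast r 2, ← Real.rpow_add hr.1]
    congr 1
    push_cast
    ring
  · refine (integrableOn_Ioi_rpow_of_lt (by linarith : -1 - σ < -1) one_pos).congr_fun
      (fun r hr => ?_) measurableSet_Ioi
    have hr1 : (1 : ℝ) < r := hr
    have hr2 : 1 ≤ r ^ 2 := one_le_pow₀ hr1.le
    simp only [smul_eq_mul, min_eq_right hr2, one_mul]
    rw [hpow r (by linarith)]

/-- Pointwise bound of the second-difference integrand: the Lévy kernel at scale `1 + ‖x‖`, plus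
far-field translates of the weight. -/
theorem exists_second_difference_div_le (N : ℕ) {a p : ℝ} (ha : 0 ≤ a) (hp : 0 < p) :
    ∃ M : ℝ, 0 ≤ M ∧ ∀ x z : EuclideanSpace ℝ (Fin N),
      |2 * fdeWeight N a x - fdeWeight N a (x + z) - fdeWeight N a (x - z)| / ‖z‖ ^ p ≤
        M * (1 + ‖x‖) ^ (-(a + p)) *
            (min (‖(1 + ‖x‖)⁻¹ • z‖ ^ 2) 1 * ‖(1 + ‖x‖)⁻¹ • z‖ ^ (-p)) +
          2 ^ p * (1 + ‖x‖) ^ (-p) * (fdeWeight N a (x + z) + fdeWeight N a (x - z)) := by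
  obtain ⟨M, hM0, hM⟩ := exists_fdeWeight_second_difference_le N ha
  set L : ℝ := 2048 ^ (a / 8)
  refine ⟨M + 8 * L, by positivity, fun x z => ?_⟩
  have hw₁ := fdeWeight_nonneg N a (x + z)
  have hw₂ := fdeWeight_nonneg N a (x - z)
  set ρ := 1 + ‖x‖
  have hρ : 0 < ρ := by positivity
  rcases eq_or_ne z 0 with rfl | hz0
  · rw [norm_zero, Real.zero_rpow hp.ne', _root_.div_zero]
    positivity
  have hz : 0 < ‖z‖ := norm_pos_iff.2 hz0
  have hscale : ‖ρ⁻¹ • z‖ = ‖z‖ / ρ := by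
    rw [norm_smul, norm_inv, Real.norm_of_nonneg hρ.le, inv_mul_eq_div]
  have hkernel : (M + 8 * L) * ρ ^ (-(a + p)) * (min (‖ρ⁻¹ • z‖ ^ 2) 1 * ‖ρ⁻¹ • z‖ ^ (-p)) =
      (M + 8 * L) * ρ ^ (-a) * min ((‖z‖ / ρ) ^ 2) 1 / ‖z‖ ^ p := by
    rw [hscale, Real.div_rpow hz.le hρ.le, neg_add, Real.rpow_add hρ, Real.rpow_neg hz.le]
    have := (Real.rpow_pos_of_pos hρ (-p)).ne'
    field_simp
  rw [hkernel]
  rcases le_total ‖z‖ (ρ / 2) with hzρ | hzρ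
  · have hmin : min ((‖z‖ / ρ) ^ 2) 1 = (‖z‖ / ρ) ^ 2 := by
      refine min_eq_left (pow_le_one₀ (by positivity) ?_)
      rw [div_le_one hρ]
      linarith
    refine le_add_of_le_of_nonneg ?_ (by positivity)
    gcongr
    rw [hmin]
    calc _ ≤ M * ρ ^ (-(a + 2)) * ‖z‖ ^ 2 := hM x z hzρ
      _ = M * ρ ^ (-a) * (‖z‖ / ρ) ^ 2 := by
        rw [neg_add, Real.rpow_add hρ, Real.rpow_neg hρ.le 2, Real.rpow_two]
        field_simp
      _ ≤ _ := by
        gcongr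
        linarith [show 0 ≤ L by positivity]
  · have hmin : 1 / 4 ≤ min ((‖z‖ / ρ) ^ 2) 1 := by
      refine le_min ?_ (by norm_num)
      have : 1 / 2 ≤ ‖z‖ / ρ := by
        rw [le_div_iff₀ hρ]
        linarith
      nlinarith
    have hx : 2 * fdeWeight N a x ≤ (M + 8 * L) * ρ ^ (-a) * min ((‖z‖ / ρ) ^ 2) 1 :=
      calc _ ≤ 2 * (L * ρ ^ (-a)) := by linarith [fdeWeight_le N ha x]
        _ = (8 * L) * ρ ^ (-a) * (1 / 4) := by ring
        _ ≤ _ := by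
          gcongr
          linarith
    have hzp : (‖z‖ ^ p)⁻¹ ≤ 2 ^ p * ρ ^ (-p) := by
      rw [← Real.rpow_neg hz.le]
      refine (Real.rpow_le_rpow_of_nonpos (by positivity) hzρ (by linarith)).trans_eq ?_
      rw [Real.div_rpow hρ.le zero_le_two, Real.rpow_neg zero_le_two, div_inv_eq_mul, mul_comm]
    have htri : |2 * fdeWeight N a x - fdeWeight N a (x + z) - fdeWeight N a (x - z)| ≤
        2 * fdeWeight N a x + (fdeWeight N a (x + z) + fdeWeight N a (x - z)) := by
      have := fdeWeight_nonneg N a x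
      rw [abs_le]
      constructor <;> linarith
    calc _ ≤ (2 * fdeWeight N a x + (fdeWeight N a (x + z) + fdeWeight N a (x - z))) / ‖z‖ ^ p := by
          gcongr
      _ = 2 * fdeWeight N a x / ‖z‖ ^ p +
          (‖z‖ ^ p)⁻¹ * (fdeWeight N a (x + z) + fdeWeight N a (x - z)) := by ring
      _ ≤ _ := by gcongr

/-- For `σ ∈ (0,2)` and `a > N`, the symmetrized second-difference integral representing
the fractional Laplacian of the weight `ϑ_a` converges at every point and is bounded by
`C / (1 + |x|^{N+σ})` for some constant `C > 0`. -/
theorem weight_fractional_laplacian_decay (N : ℕ) (hN : 0 < N) (σ a : ℝ)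
    (hσ0 : 0 < σ) (hσ2 : σ < 2) (ha : (N : ℝ) < a) :
    ∃ C : ℝ, 0 < C ∧ ∀ x : EuclideanSpace ℝ (Fin N),
      ∫⁻ z : EuclideanSpace ℝ (Fin N),
          ENNReal.ofReal
            (|2 * fdeWeight N a x - fdeWeight N a (x + z) - fdeWeight N a (x - z)| /
              ‖z‖ ^ ((N : ℝ) + σ))
        ≤ ENNReal.ofReal (C / (1 + ‖x‖ ^ ((N : ℝ) + σ))) := by
  have ha0 : 0 ≤ a := N.cast_nonneg.trans ha.le
  have hp : 0 < (N : ℝ) + σ := by positivity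
  obtain ⟨M, hM0, hM⟩ := exists_second_difference_div_le N ha0 hp
  set p := (N : ℝ) + σ with hp_def
  have hk := integrable_min_norm_sq_mul_rpow N hN hσ0 hσ2
  rw [← hp_def] at hk
  have hw : Integrable (fdeWeight N a) :=
    ⟨(measurable_fdeWeight N a).aestronglyMeasurable,
      (hasFiniteIntegral_iff_ofReal (.of_forall (fdeWeight_nonneg N a))).2
        (lintegral_fdeWeight_lt_top N ha)⟩
  set K := ∫ z : EuclideanSpace ℝ (Fin N), min (‖z‖ ^ 2) 1 * ‖z‖ ^ (-p)
  set W := ∫ z, fdeWeight N a z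
  have hK0 : 0 ≤ K := integral_nonneg fun z => by positivity
  have hW0 : 0 ≤ W := integral_nonneg (fdeWeight_nonneg N a)
  refine ⟨2 * (M * K + 2 ^ p * (W + W) + 1), by positivity, fun x => ?_⟩
  set ρ := 1 + ‖x‖
  have hρ1 : 1 ≤ ρ := by linarith [norm_nonneg x]
  have hρ : 0 < ρ := by positivity
  have hkρ := hk.comp_smul (inv_ne_zero hρ.ne')
  have hw₁ := hw.comp_add_left x
  have hw₂ := hw.comp_sub_left x
  have hw₁₂ : Integrable fun z => fdeWeight N a (x + z) + fdeWeight N a (x - z) := hw₁.add hw₂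
  have hbound_int := (hkρ.const_mul (M * ρ ^ (-(a + p)))).add
    (hw₁₂.const_mul (2 ^ p * ρ ^ (-p)))
  refine (lintegral_mono fun z => ENNReal.ofReal_le_ofReal (hM x z)).trans ?_
  have hpos : ∀ z : EuclideanSpace ℝ (Fin N), 0 ≤ M * ρ ^ (-(a + p)) *
      (min (‖ρ⁻¹ • z‖ ^ 2) 1 * ‖ρ⁻¹ • z‖ ^ (-p)) +
      2 ^ p * ρ ^ (-p) * (fdeWeight N a (x + z) + fdeWeight N a (x - z)) := fun z => by
    have := fdeWeight_nonneg N a (x + z)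
    have := fdeWeight_nonneg N a (x - z)
    positivity
  refine (ofReal_integral_eq_lintegral_ofReal hbound_int (.of_forall hpos)).symm.trans_le ?_
  refine ENNReal.ofReal_le_ofReal ?_
  have hscale : ∫ z : EuclideanSpace ℝ (Fin N), min (‖ρ⁻¹ • z‖ ^ 2) 1 * ‖ρ⁻¹ • z‖ ^ (-p) =
      ρ ^ N * K := by
    have h := Measure.integral_comp_inv_smul (volume : Measure (EuclideanSpace ℝ (Fin N)))
      (fun z => min (‖z‖ ^ 2) 1 * ‖z‖ ^ (-p)) ρ
    rwa [finrank_euclideanSpace_fin, abs_of_nonneg (by positivity), smul_eq_mul] at h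
  have hval : ∫ z : EuclideanSpace ℝ (Fin N), (M * ρ ^ (-(a + p)) *
      (min (‖ρ⁻¹ • z‖ ^ 2) 1 * ‖ρ⁻¹ • z‖ ^ (-p)) +
      2 ^ p * ρ ^ (-p) * (fdeWeight N a (x + z) + fdeWeight N a (x - z))) =
      M * ρ ^ (-(a + p)) * (ρ ^ N * K) + 2 ^ p * ρ ^ (-p) * (W + W) := by
    rw [integral_add (hkρ.const_mul _) (hw₁₂.const_mul _), integral_const_mul,
      integral_const_mul, integral_add hw₁ hw₂, hscale, integral_add_left_eq_self (fdeWeight N a),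
      integral_sub_left_eq_self (fdeWeight N a)]
  refine hval.trans_le ?_
  have hρa : ρ ^ (-(a + p)) * ρ ^ N ≤ ρ ^ (-p) := by
    rw [← Real.rpow_natCast, ← Real.rpow_add hρ]
    exact Real.rpow_le_rpow_of_exponent_le hρ1 (by linarith)
  have hden : 1 + ‖x‖ ^ p ≤ 2 * ρ ^ p := by
    have h₁ : 1 ≤ ρ ^ p := Real.one_le_rpow hρ1 hp.le
    have h₂ : ‖x‖ ^ p ≤ ρ ^ p := Real.rpow_le_rpow (norm_nonneg x) (by linarith) hp.le
    linarith
  calc M * ρ ^ (-(a + p)) * (ρ ^ N * K) + 2 ^ p * ρ ^ (-p) * (W + W)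
      = M * K * (ρ ^ (-(a + p)) * ρ ^ N) + 2 ^ p * (W + W) * ρ ^ (-p) := by ring
    _ ≤ M * K * ρ ^ (-p) + 2 ^ p * (W + W) * ρ ^ (-p) := by gcongr
    _ ≤ (M * K + 2 ^ p * (W + W) + 1) * ρ ^ (-p) := by
        linarith [Real.rpow_pos_of_pos hρ (-p)]
    _ = 2 * (M * K + 2 ^ p * (W + W) + 1) / (2 * ρ ^ p) := by
        rw [Real.rpow_neg hρ.le]
        field_simp
    _ ≤ _ := by gcongr
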